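/- Global stability of the fluid limit: for any initial condition (q(0), δ(0)) ∈ E, the solution of the fluid-limit dynamics with constant arrival rate 0 < λ < 1 satisfies (q(t), δ(t)) → (q*, δ*) as t → ∞, where q₁* = λ, qᵢ* = 0 for i = 2,…,B, δ₀* = 1−λ, δ₁* = 0. -/

import Mathlib

open Finset

/-- The coefficient `p₀(q, δ, λ)` of the fluid-limit dynamics:
`p₀ = 1` if `u = 1 - q₁ - δ₀ - δ₁ > 0`, and `min{λ⁻¹(δ₁ν + q₁ - q₂), 1}` otherwise. -/
noncomputable def fluidP0 (lam nu : ℝ) (q : ℕ → ℝ) (d0 d1 : ℝ) : ℝ :=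
  if 1 - q 1 - d0 - d1 > 0 then 1 else min (lam⁻¹ * (d1 * nu + q 1 - q 2)) 1

/-- The coefficients `pᵢ(q, δ, λ)`: `p₀` as above, and
`pᵢ = (1 - p₀)(qᵢ - q_{i+1})/q₁` for `i ≥ 1`. -/
noncomputable def fluidP (lam nu : ℝ) (q : ℕ → ℝ) (d0 d1 : ℝ) : ℕ → ℝ
  | 0 => fluidP0 lam nu q d0 d1
  | (i + 1) => (1 - fluidP0 lam nu q d0 d1) * (q (i + 1) - q (i + 2)) / q 1

/-- Drift (right-hand side of the ODE) for `qᵢ`, `i = 1, …, B`: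
`λ p_{i-1}(q, δ, λ) - (qᵢ - q_{i+1})`. -/
noncomputable def driftQ (lam nu : ℝ) (q : ℕ → ℝ) (d0 d1 : ℝ) (i : ℕ) : ℝ :=
  lam * fluidP lam nu q d0 d1 (i - 1) - (q i - q (i + 1))

/-- Drift for `δ₀`: `μu - λ(1 - p₀)1{δ₀ > 0}`, with `u = 1 - q₁ - δ₀ - δ₁`. -/
noncomputable def driftD0 (lam mu nu : ℝ) (q : ℕ → ℝ) (d0 d1 : ℝ) : ℝ :=
  mu * (1 - q 1 - d0 - d1) -
    lam * (1 - fluidP0 lam nu q d0 d1) * (if d0 > 0 then 1 else 0)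

/-- Drift for `δ₁`: `λ(1 - p₀)1{δ₀ > 0} - νδ₁`. -/
noncomputable def driftD1 (lam nu : ℝ) (q : ℕ → ℝ) (d0 d1 : ℝ) : ℝ :=
  lam * (1 - fluidP0 lam nu q d0 d1) * (if d0 > 0 then 1 else 0) - nu * d1

open Filter Finset

/-- A measurable function that is bounded on `[0, ∞)` is integrable on its bounded intervals. -/
lemma intervalIntegrable_of_abs_le {φ : ℝ → ℝ} (hm : Measurable φ) {C : ℝ}
    (hC : ∀ s, 0 ≤ s → |φ s| ≤ C) {a b : ℝ} (ha : 0 ≤ a) (hb : 0 ≤ b) :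
    IntervalIntegrable φ MeasureTheory.volume a b := by
  refine (intervalIntegrable_const (c := C)).mono_fun' hm.aestronglyMeasurable ?_
  refine (MeasureTheory.ae_restrict_iff' measurableSet_uIoc).2 (Eventually.of_forall fun s hs => ?_)
  rw [Set.mem_uIoc] at hs
  exact hC s (by rcases hs with h | h <;> linarith [h.1])

/-- `f` is an absolutely continuous function on `[0, ∞)` with density `φ`. -/
def HasDrift (f φ : ℝ → ℝ) : Prop :=
  (∀ a b, 0 ≤ a → 0 ≤ b → IntervalIntegrable φ MeasureTheory.volume a b) ∧
    ∀ s t, 0 ≤ s → s ≤ t → f t - f s = ∫ r in s..t, φ r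

/-- `f` is Lipschitz on `[0, ∞)`. -/
def LipschitzIci (f : ℝ → ℝ) : Prop :=
  ∃ L : ℝ, ∀ s t, 0 ≤ s → s ≤ t → |f t - f s| ≤ L * (t - s)

namespace HasDrift

variable {f g φ ψ : ℝ → ℝ}

lemma of_eq_add_integral (hφ : ∀ a b, 0 ≤ a → 0 ≤ b →
      IntervalIntegrable φ MeasureTheory.volume a b)
    (h : ∀ t, 0 ≤ t → f t = f 0 + ∫ r in (0 : ℝ)..t, φ r) : HasDrift f φ := by
  refine ⟨hφ, fun s t hs hst => ?_⟩
  have ht := hs.trans hst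
  rw [h t ht, h s hs, ← intervalIntegral.integral_add_adjacent_intervals
    (hφ 0 s le_rfl hs) (hφ s t hs ht)]
  ring

lemma add (hf : HasDrift f φ) (hg : HasDrift g ψ) :
    HasDrift (fun t => f t + g t) (fun t => φ t + ψ t) := by
  refine ⟨fun a b ha hb => (hf.1 a b ha hb).add (hg.1 a b ha hb), fun s t hs hst => ?_⟩
  rw [intervalIntegral.integral_add (hf.1 s t hs (hs.trans hst)) (hg.1 s t hs (hs.trans hst)),
    ← hf.2 s t hs hst, ← hg.2 s t hs hst]
  ring

lemma neg (hf : HasDrift f φ) : HasDrift (fun t => -f t) (fun t => -φ t) := by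
  refine ⟨fun a b ha hb => (hf.1 a b ha hb).neg, fun s t hs hst => ?_⟩
  rw [intervalIntegral.integral_neg, ← hf.2 s t hs hst]
  ring

lemma const (c : ℝ) : HasDrift (fun _ => c) (fun _ => 0) :=
  ⟨fun _ _ _ _ => intervalIntegrable_const, fun s t _ _ => by simp⟩

lemma sum {ι : Type*} (s : Finset ι) {F Φ : ι → ℝ → ℝ} (h : ∀ i ∈ s, HasDrift (F i) (Φ i)) :
    HasDrift (fun t => ∑ i ∈ s, F i t) (fun t => ∑ i ∈ s, Φ i t) := by
  classical
  induction s using Finset.induction_on with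
  | empty => simpa using HasDrift.const 0
  | insert a s ha ih =>
    simp only [Finset.sum_insert ha]
    exact (h a (Finset.mem_insert_self a s)).add
      (ih fun i hi => h i (Finset.mem_insert_of_mem hi))

lemma sub_le_integral (hf : HasDrift f φ) {s t : ℝ} (hs : 0 ≤ s) (hst : s ≤ t)
    (hψ : IntervalIntegrable ψ MeasureTheory.volume s t)
    (h : ∀ r ∈ Set.Icc s t, φ r ≤ ψ r) : f t - f s ≤ ∫ r in s..t, ψ r := by
  rw [hf.2 s t hs hst]
  exact intervalIntegral.integral_mono_on hst (hf.1 s t hs (hs.trans hst)) hψ h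

lemma sub_le (hf : HasDrift f φ) {s t m : ℝ} (hs : 0 ≤ s) (hst : s ≤ t)
    (h : ∀ r ∈ Set.Icc s t, φ r ≤ m) : f t - f s ≤ m * (t - s) := by
  have := hf.sub_le_integral hs hst intervalIntegrable_const h
  rw [intervalIntegral.integral_const, smul_eq_mul] at this
  linarith

lemma lipschitzIci (hf : HasDrift f φ) {C : ℝ} (hC : ∀ t, 0 ≤ t → |φ t| ≤ C) :
    LipschitzIci f := by
  refine ⟨C, fun s t hs hst => abs_le.2 ⟨?_, ?_⟩⟩
  · have := hf.neg.sub_le (m := C) hs hst fun r hr =>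
      by linarith [(abs_le.1 (hC r (hs.trans hr.1))).1]
    linarith
  · exact hf.sub_le hs hst fun r hr => (abs_le.1 (hC r (hs.trans hr.1))).2

end HasDrift

namespace LipschitzIci

variable {f g : ℝ → ℝ}

lemma const (c : ℝ) : LipschitzIci fun _ => c := ⟨0, fun s t _ _ => by simp⟩

lemma add (hf : LipschitzIci f) (hg : LipschitzIci g) : LipschitzIci fun t => f t + g t := by
  obtain ⟨K, hK⟩ := hf
  obtain ⟨L, hL⟩ := hg
  refine ⟨K + L, fun s t hs hst => ?_⟩
  have h := abs_add_le (f t - f s) (g t - g s)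
  have h1 := hK s t hs hst
  have h2 := hL s t hs hst
  rw [show f t + g t - (f s + g s) = f t - f s + (g t - g s) by ring]
  linarith

lemma const_mul (c : ℝ) (hf : LipschitzIci f) : LipschitzIci fun t => c * f t := by
  obtain ⟨K, hK⟩ := hf
  refine ⟨|c| * K, fun s t hs hst => ?_⟩
  rw [← mul_sub, abs_mul, mul_assoc]
  exact mul_le_mul_of_nonneg_left (hK s t hs hst) (abs_nonneg c)

lemma sub (hf : LipschitzIci f) (hg : LipschitzIci g) : LipschitzIci fun t => f t - g t := by
  have := hf.add (hg.const_mul (-1))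
  simpa [sub_eq_add_neg] using this

lemma max (hf : LipschitzIci f) (hg : LipschitzIci g) :
    LipschitzIci fun t => Max.max (f t) (g t) := by
  obtain ⟨K, hK⟩ := hf
  obtain ⟨L, hL⟩ := hg
  refine ⟨Max.max K L, fun s t hs hst => (abs_max_sub_max_le_max _ _ _ _).trans (max_le ?_ ?_)⟩
  · exact (hK s t hs hst).trans
      (mul_le_mul_of_nonneg_right (le_max_left _ _) (sub_nonneg.2 hst))
  · exact (hL s t hs hst).trans
      (mul_le_mul_of_nonneg_right (le_max_right _ _) (sub_nonneg.2 hst))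

lemma min (hf : LipschitzIci f) (hg : LipschitzIci g) :
    LipschitzIci fun t => Min.min (f t) (g t) := by
  obtain ⟨K, hK⟩ := hf
  obtain ⟨L, hL⟩ := hg
  refine ⟨Max.max K L, fun s t hs hst => (abs_min_sub_min_le_max _ _ _ _).trans (max_le ?_ ?_)⟩
  · exact (hK s t hs hst).trans
      (mul_le_mul_of_nonneg_right (le_max_left _ _) (sub_nonneg.2 hst))
  · exact (hL s t hs hst).trans
      (mul_le_mul_of_nonneg_right (le_max_right _ _) (sub_nonneg.2 hst))

/-- A Lipschitz function keeps half of its value on a window of uniform length. -/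
lemma exists_window (hf : LipschitzIci f) {ε : ℝ} (hε : 0 < ε) :
    ∃ c, 0 < c ∧ ∀ t, 0 ≤ t → ε ≤ f t → ∀ r ∈ Set.Icc t (t + c), ε / 2 ≤ f r := by
  obtain ⟨L, hL⟩ := hf
  have hL' : 0 < |L| + 1 := by positivity
  refine ⟨ε / (2 * (|L| + 1)), by positivity, fun t ht hft r hr => ?_⟩
  have h1 := (abs_le.1 (hL t r ht hr.1)).1
  have h2 : L * (r - t) ≤ (|L| + 1) * (r - t) :=
    mul_le_mul_of_nonneg_right (by linarith [le_abs_self L]) (by linarith [hr.1])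
  have h3 : (|L| + 1) * (r - t) ≤ (|L| + 1) * (ε / (2 * (|L| + 1))) :=
    mul_le_mul_of_nonneg_left (by linarith [hr.2]) hL'.le
  have h4 : (|L| + 1) * (ε / (2 * (|L| + 1))) = ε / 2 := by field_simp
  linarith

end LipschitzIci

/-- A continuous function that does not increase while it is above `c` never crosses `c` upwards. -/
lemma le_of_nonincreasing_above {f : ℝ → ℝ} (hf : Continuous f) {a b c : ℝ} (hab : a ≤ b)
    (ha : f a ≤ c)
    (h : ∀ s t, a ≤ s → s ≤ t → (∀ r ∈ Set.Icc s t, c ≤ f r) → f t ≤ f s) : f b ≤ c := by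
  by_contra! hb
  let A := Set.Icc a b ∩ f ⁻¹' Set.Iic c
  have hA : IsCompact A := isCompact_Icc.inter_right (isClosed_Iic.preimage hf)
  have hne : A.Nonempty := ⟨a, ⟨le_rfl, hab⟩, ha⟩
  have hs := hA.sSup_mem hne
  set s := sSup A
  have habove : ∀ r ∈ Set.Ioc s b, c ≤ f r := fun r hr => by
    by_contra! hc
    exact absurd (le_csSup hA.bddAbove ⟨⟨hs.1.1.trans hr.1.le, hr.2⟩, hc.le⟩) (not_le.2 hr.1)
  have hsb : s < b := lt_of_le_of_ne hs.1.2 fun heq => by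
    have : f s ≤ c := hs.2
    rw [heq] at this
    linarith
  have hcs : c ≤ f s := by
    have hmem : s ∈ closure (Set.Ioc s b) := by
      rw [closure_Ioc hsb.ne]
      exact ⟨le_rfl, hsb.le⟩
    exact closure_minimal (t := f ⁻¹' Set.Ici c) habove (isClosed_Ici.preimage hf) hmem
  have := h s b hs.1.1 hsb.le fun r hr => by
    rcases hr.1.eq_or_lt with rfl | h'
    · exact hcs
    · exact habove r ⟨h', hr.2⟩
  have hs2 : f s ≤ c := hs.2
  linarith

/-- Solutions of `f' ≤ g - k f` with `g → 0` and `k > 0` tend to `0`. -/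
lemma HasDrift.tendsto_zero {f φ g : ℝ → ℝ} (hfc : Continuous f) (hf : HasDrift f φ)
    (hf0 : ∀ t, 0 ≤ t → 0 ≤ f t) {k : ℝ} (hk : 0 < k)
    (hφ : ∀ t, 0 ≤ t → φ t ≤ g t - k * f t) (hg : Tendsto g atTop (nhds 0)) :
    Tendsto f atTop (nhds 0) := by
  rw [Metric.tendsto_atTop]
  intro ε hε
  obtain ⟨T, hT⟩ := eventually_atTop.1
    (((tendsto_order.1 hg).2 (k * ε / 4) (by positivity)).and (eventually_ge_atTop 0))
  have hT0 : 0 ≤ T := (hT T le_rfl).2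
  obtain ⟨a, haT, ha⟩ : ∃ a, T ≤ a ∧ f a ≤ ε / 2 := by
    by_contra! hcon
    have hlen : 0 ≤ f T / (k * ε / 4) := div_nonneg (hf0 T hT0) (by positivity)
    have h1 := hf.sub_le (s := T) (t := T + f T / (k * ε / 4)) (m := -(k * ε / 4)) hT0
      (by linarith) fun r hr => by
        have h2 := hφ r (hT0.trans hr.1)
        have h3 := (hT r hr.1).1
        have h4 := mul_lt_mul_of_pos_left (hcon r hr.1) hk
        linarith
    have h5 := hcon (T + f T / (k * ε / 4)) (by linarith)
    have h6 : -(k * ε / 4) * (T + f T / (k * ε / 4) - T) = -f T := by field_simp; ring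
    linarith
  refine ⟨a, fun t hat => ?_⟩
  have hle : f t ≤ ε / 2 := le_of_nonincreasing_above hfc hat ha fun s t has hst hr => by
    have := hf.sub_le (m := 0) (hT0.trans (haT.trans has)) hst fun r hrm => by
      have h2 := hφ r (hT0.trans (haT.trans (has.trans hrm.1)))
      have h3 := (hT r (haT.trans (has.trans hrm.1))).1
      have h4 := mul_le_mul_of_nonneg_left (hr r hrm) hk.le
      nlinarith
    linarith
  rw [Real.dist_eq, sub_zero, abs_of_nonneg (hf0 t (hT0.trans (haT.trans hat)))]
  linarith

/-- If the integrals of a nonnegative function are bounded, those over far away windows of a fixed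
length vanish. -/
lemma tendsto_integral_window {h : ℝ → ℝ}
    (hi : ∀ a b, 0 ≤ a → 0 ≤ b → IntervalIntegrable h MeasureTheory.volume a b)
    (h0 : ∀ t, 0 ≤ t → 0 ≤ h t) {C : ℝ} (hC : ∀ t, 0 ≤ t → ∫ r in (0 : ℝ)..t, h r ≤ C)
    {c : ℝ} (hc : 0 ≤ c) :
    Tendsto (fun t => ∫ r in t..(t + c), h r) atTop (nhds 0) := by
  let I : ℝ → ℝ := fun t => ∫ r in (0 : ℝ)..(max t 0), h r
  have hm : Monotone I := fun s t hst => by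
    have h1 := intervalIntegral.integral_add_adjacent_intervals
      (hi 0 (max s 0) le_rfl (le_max_right _ _))
      (hi (max s 0) (max t 0) (le_max_right _ _) (le_max_right _ _))
    have h2 : 0 ≤ ∫ r in (max s 0)..(max t 0), h r :=
      intervalIntegral.integral_nonneg (max_le_max_right 0 hst)
        fun r hr => h0 r ((le_max_right _ _).trans hr.1)
    change (∫ r in (0 : ℝ)..(max s 0), h r) ≤ ∫ r in (0 : ℝ)..(max t 0), h r
    linarith
  have hb : BddAbove (Set.range I) := ⟨C, by
    rintro _ ⟨t, rfl⟩
    exact hC _ (le_max_right _ _)⟩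
  have hl := tendsto_atTop_ciSup hm hb
  have hd := (hl.comp (tendsto_atTop_add_const_right atTop c tendsto_id)).sub hl
  rw [sub_self] at hd
  refine hd.congr' ?_
  filter_upwards [eventually_ge_atTop 0] with t ht
  have h1 := intervalIntegral.integral_add_adjacent_intervals
    (hi 0 t le_rfl ht) (hi t (t + c) ht (by linarith))
  simp only [I, Function.comp, id, max_eq_left ht, max_eq_left (add_nonneg ht hc)]
  linarith

/-- Barbalat's lemma: a nonnegative Lipschitz function dominated by a function with bounded
integrals tends to `0`. -/
lemma LipschitzIci.tendsto_zero {f h : ℝ → ℝ} (hf : LipschitzIci f)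
    (hf0 : ∀ t, 0 ≤ t → 0 ≤ f t) (hfh : ∀ t, 0 ≤ t → f t ≤ h t)
    (hi : ∀ a b, 0 ≤ a → 0 ≤ b → IntervalIntegrable h MeasureTheory.volume a b)
    {C : ℝ} (hC : ∀ t, 0 ≤ t → ∫ r in (0 : ℝ)..t, h r ≤ C) :
    Tendsto f atTop (nhds 0) := by
  rw [Metric.tendsto_atTop]
  intro ε hε
  obtain ⟨c, hc, hw⟩ := hf.exists_window hε
  have ht := tendsto_integral_window hi (fun t ht => (hf0 t ht).trans (hfh t ht)) hC hc.le
  obtain ⟨T, hT⟩ := eventually_atTop.1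
    (((tendsto_order.1 ht).2 (ε / 2 * c) (by positivity)).and (eventually_ge_atTop 0))
  refine ⟨T, fun t htT => ?_⟩
  have ht0 := (hT t htT).2
  rw [Real.dist_eq, sub_zero, abs_of_nonneg (hf0 t ht0)]
  by_contra! hcon
  have h1 : (∫ _ in t..(t + c), ε / 2) ≤ ∫ r in t..(t + c), h r :=
    intervalIntegral.integral_mono_on (by linarith) intervalIntegrable_const
      (hi t (t + c) ht0 (by linarith))
      fun r hr => (hw t ht0 hcon r hr).trans (hfh r (ht0.trans hr.1))
  rw [intervalIntegral.integral_const, smul_eq_mul] at h1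
  have h2 := (hT t htT).1
  nlinarith

/-- Convergence of the fluid dynamics in terms of `x = q₁`, `y = q₂` and the rate `w = λ(1 - p₀)`
of arrivals that do not find an idle server, provided the excess `(x - λ)⁺` is integrable. -/
lemma fluid_tendsto_of_integral_excess_le {lam mu nu : ℝ} (hlam0 : 0 < lam) (hlam1 : lam < 1)
    (hmu : 0 < mu) (hnu : 0 < nu) {x y d0 d1 w : ℝ → ℝ}
    (hxc : Continuous x) (hyc : Continuous y) (hd0c : Continuous d0) (hd1c : Continuous d1)
    (hx0 : ∀ t, 0 ≤ t → 0 ≤ x t) (hy0 : ∀ t, 0 ≤ t → 0 ≤ y t)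
    (hyx : ∀ t, 0 ≤ t → y t ≤ x t) (hd0 : ∀ t, 0 ≤ t → 0 ≤ d0 t) (hd1 : ∀ t, 0 ≤ t → 0 ≤ d1 t)
    (hsum : ∀ t, 0 ≤ t → d0 t + d1 t + x t ≤ 1)
    (hw_pos : ∀ t, 0 ≤ t → 0 < 1 - x t - d0 t - d1 t → w t = 0)
    (hw_zero : ∀ t, 0 ≤ t → 1 - x t - d0 t - d1 t = 0 →
      w t = max (lam - x t + y t - nu * d1 t) 0)
    (hw_le : ∀ t, 0 ≤ t → w t ≤ lam)
    (hxd : HasDrift x fun t => lam - x t + y t - w t) (hyl : LipschitzIci y)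
    (hd0d : HasDrift d0 fun t =>
      mu * (1 - x t - d0 t - d1 t) - if d0 t > 0 then w t else 0)
    (hd1d : HasDrift d1 fun t => (if d0 t > 0 then w t else 0) - nu * d1 t)
    {C : ℝ} (hC : ∀ t, 0 ≤ t → ∫ r in (0 : ℝ)..t, max (x r - lam) 0 ≤ C) :
    Tendsto x atTop (nhds lam) ∧ Tendsto y atTop (nhds 0) ∧
      Tendsto d0 atTop (nhds (1 - lam)) ∧ Tendsto d1 atTop (nhds 0) := by
  have hx1 : ∀ t, 0 ≤ t → x t ≤ 1 := fun t ht => by linarith [hsum t ht, hd0 t ht, hd1 t ht]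
  have hd11 : ∀ t, 0 ≤ t → d1 t ≤ 1 := fun t ht => by linarith [hsum t ht, hd0 t ht, hx0 t ht]
  have hu0 : ∀ t, 0 ≤ t → 0 ≤ 1 - x t - d0 t - d1 t := fun t ht => by linarith [hsum t ht]
  have hw0 : ∀ t, 0 ≤ t → 0 ≤ w t := fun t ht => by
    rcases (hu0 t ht).eq_or_lt with h | h
    · rw [hw_zero t ht h.symm]; exact le_max_right _ _
    · rw [hw_pos t ht h]
  have hv0 : ∀ t, 0 ≤ t → 0 ≤ (if d0 t > 0 then w t else 0) := fun t ht => by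
    split_ifs
    exacts [hw0 t ht, le_rfl]
  have hvw : ∀ t, 0 ≤ t → (if d0 t > 0 then w t else 0) ≤ w t := fun t ht => by
    split_ifs
    exacts [le_rfl, hw0 t ht]
  have hdom : ∀ t, 0 ≤ t → min (max (1 - x t - d0 t - d1 t) (nu * d1 t))
      (max (lam - x t + y t) 0) ≤ max (lam - x t + y t) 0 - w t := fun t ht => by
    rcases (hu0 t ht).eq_or_lt with h | h
    · have hnd := mul_nonneg hnu.le (hd1 t ht)
      rw [hw_zero t ht h.symm, ← h, max_eq_right hnd]
      rcases le_total (lam - x t + y t - nu * d1 t) 0 with h1 | h1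
      · rw [max_eq_right h1, sub_zero]
        exact min_le_right _ _
      · rw [max_eq_left h1]
        refine (min_le_left _ _).trans ?_
        linarith [le_max_left (lam - x t + y t) 0]
    · rw [hw_pos t ht h, sub_zero]
      exact min_le_right _ _
  have hmin0 : ∀ t, 0 ≤ t → 0 ≤ min (max (1 - x t - d0 t - d1 t) (nu * d1 t))
      (max (lam - x t + y t) 0) := fun t ht =>
    le_min ((hu0 t ht).trans (le_max_left _ _)) (le_max_right _ _)
  have hxl : LipschitzIci x := hxd.lipschitzIci (C := 2) fun t ht =>
    abs_le.2 ⟨by linarith [hw_le t ht, hx1 t ht, hy0 t ht],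
      by linarith [hw0 t ht, hyx t ht]⟩
  have hd1l : LipschitzIci d1 := hd1d.lipschitzIci (C := 1 + nu) fun t ht => by
    have h1 := mul_le_mul_of_nonneg_left (hd11 t ht) hnu.le
    have h2 := mul_nonneg hnu.le (hd1 t ht)
    have h3 := hv0 t ht
    have h4 := hvw t ht
    have h5 := hw_le t ht
    exact abs_le.2 ⟨by linarith, by linarith⟩
  have hd0l : LipschitzIci d0 := hd0d.lipschitzIci (C := mu + 1) fun t ht => by
    have h1 : mu * (1 - x t - d0 t - d1 t) ≤ mu * 1 :=
      mul_le_mul_of_nonneg_left (by linarith [hx0 t ht, hd0 t ht, hd1 t ht]) hmu.le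
    have h2 := mul_nonneg hmu.le (hu0 t ht)
    have h3 := hv0 t ht
    have h4 := hvw t ht
    have h5 := hw_le t ht
    exact abs_le.2 ⟨by linarith, by linarith⟩
  have hzl : LipschitzIci fun t => max (lam - x t + y t) 0 :=
    (((LipschitzIci.const lam).sub hxl).add hyl).max (LipschitzIci.const 0)
  have hhi : ∀ a b, 0 ≤ a → 0 ≤ b → IntervalIntegrable
      (fun t => max (lam - x t + y t) 0 - w t) MeasureTheory.volume a b := fun a b ha hb => by
    have h1 : Continuous fun t => max (lam - x t + y t) 0 - (lam - x t + y t) := by fun_prop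
    refine ((h1.intervalIntegrable a b).add (hxd.1 a b ha hb)).congr ?_
    exact fun t _ => sub_add_sub_cancel _ _ _
  have hexi : Continuous fun t => max (x t - lam) 0 := by fun_prop
  have hhC : ∀ t, 0 ≤ t →
      ∫ r in (0 : ℝ)..t, (max (lam - x r + y r) 0 - w r) ≤ 1 + C := fun t ht => by
    have h1 := intervalIntegral.integral_mono_on ht (hhi 0 t le_rfl ht)
      ((hxd.1 0 t le_rfl ht).add (hexi.intervalIntegrable 0 t)) fun r hr => by
        have h2 := hy0 r hr.1
        change max (lam - x r + y r) 0 - w r ≤ lam - x r + y r - w r + max (x r - lam) 0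
        rcases max_cases (lam - x r + y r) 0 with h | h <;>
          linarith [le_max_left (x r - lam) 0, le_max_right (x r - lam) 0]
    have h3 := intervalIntegral.integral_add (hxd.1 0 t le_rfl ht) (hexi.intervalIntegrable 0 t)
    have h4 := hxd.2 0 t le_rfl ht
    have h5 := hC t ht
    have h6 := hx1 t ht
    have h7 := hx0 0 le_rfl
    linarith
  have hminlim := LipschitzIci.tendsto_zero
    (((((LipschitzIci.const 1).sub hxl).sub hd0l).sub hd1l).max (hd1l.const_mul nu) |>.min hzl)
    hmin0 hdom hhi hhC
  have hexlim : Tendsto (fun t => max (x t - lam) 0) atTop (nhds 0) :=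
    LipschitzIci.tendsto_zero ((hxl.sub (LipschitzIci.const lam)).max (LipschitzIci.const 0))
      (fun t _ => le_max_right _ _) (fun t _ => le_rfl)
      (fun a b _ _ => hexi.intervalIntegrable a b) hC
  have hzlim : Tendsto (fun t => max (lam - x t + y t) 0) atTop (nhds 0) := by
    rw [Metric.tendsto_atTop]
    intro ε hε
    obtain ⟨c, hc, hwin⟩ := hzl.exists_window hε
    have hIlim := tendsto_integral_window hhi
      (fun t ht => (hmin0 t ht).trans (hdom t ht)) hhC hc.le
    have hgap : 0 < 1 - lam := by linarith
    obtain ⟨η, hη, hη1, hη2, hη3, hη4⟩ : ∃ η > 0, η ≤ ε / 8 ∧ η ≤ (1 - lam) / 8 ∧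
        η ≤ nu * ((1 - lam) / 8) ∧ η ≤ nu * (c * ε / 8) :=
      ⟨min (min (ε / 8) ((1 - lam) / 8)) (min (nu * ((1 - lam) / 8)) (nu * (c * ε / 8))),
        by positivity, (min_le_left _ _).trans (min_le_left _ _),
        (min_le_left _ _).trans (min_le_right _ _), (min_le_right _ _).trans (min_le_left _ _),
        (min_le_right _ _).trans (min_le_right _ _)⟩
    obtain ⟨T, hT⟩ := eventually_atTop.1
      ((((tendsto_order.1 hIlim).2 (c * ε / 8) (by positivity)).and
        ((tendsto_order.1 hminlim).2 η hη)).and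
        (((tendsto_order.1 hexlim).2 ((1 - lam) / 8) (by positivity)).and
          (eventually_ge_atTop 0)))
    refine ⟨T, fun t htT => ?_⟩
    have ht0 := (hT t htT).2.2
    rw [Real.dist_eq, sub_zero, abs_of_nonneg (le_max_right _ _)]
    by_contra! hcon
    have hsmall : ∀ r ∈ Set.Icc t (t + c),
        1 - x r - d0 r - d1 r < η ∧ nu * d1 r < η := fun r hr => by
      have h1 := (hT r (htT.trans hr.1)).1.2
      have h2 := hwin t ht0 hcon r hr
      rcases min_lt_iff.1 h1 with h | h
      · exact max_lt_iff.1 h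
      · linarith
    have hd0pos : ∀ r ∈ Set.Icc t (t + c), 0 < d0 r := fun r hr => by
      obtain ⟨h1, h2⟩ := hsmall r hr
      have h3 := (hT r (htT.trans hr.1)).2.1
      have h4 := lt_of_mul_lt_mul_left (h2.trans_le hη3) hnu.le
      linarith [le_max_left (x r - lam) 0]
    have hlow := hd1d.neg.sub_le_integral (s := t) (t := t + c) ht0 (by linarith)
      ((hhi t (t + c) ht0 (by linarith)).add
        (intervalIntegrable_const (c := -(3 * ε / 8)))) fun r hr => by
        have h1 := (hsmall r hr).2
        have h2 := hwin t ht0 hcon r hr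
        simp only [if_pos (hd0pos r hr)]
        change -(w r - nu * d1 r) ≤ max (lam - x r + y r) 0 - w r + -(3 * ε / 8)
        linarith
    have hadd := intervalIntegral.integral_add (hhi t (t + c) ht0 (by linarith))
        (intervalIntegrable_const (c := -(3 * ε / 8)) (a := t) (b := t + c)
          (μ := MeasureTheory.volume))
    rw [intervalIntegral.integral_const, smul_eq_mul] at hadd
    have h1 := (hT t htT).1.1
    have h2 := (hsmall (t + c) ⟨by linarith, le_rfl⟩).2
    have h3 := lt_of_mul_lt_mul_left (h2.trans_le hη4) hnu.le
    have h4 := hd1 t ht0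
    have h5 : 0 < c * ε := mul_pos hc hε
    nlinarith
  have hxlim : Tendsto x atTop (nhds lam) := by
    have hl : Tendsto (fun t => lam - max (lam - x t + y t) 0) atTop (nhds lam) := by
      simpa using tendsto_const_nhds.sub hzlim
    have hr : Tendsto (fun t => lam + max (x t - lam) 0) atTop (nhds lam) := by
      simpa using tendsto_const_nhds.add hexlim
    refine tendsto_of_tendsto_of_tendsto_of_le_of_le' hl hr ?_ ?_
    · filter_upwards [eventually_ge_atTop 0] with t ht
      linarith [le_max_left (lam - x t + y t) 0, hy0 t ht]
    · exact Eventually.of_forall fun t => by linarith [le_max_left (x t - lam) 0]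
  have hylim : Tendsto y atTop (nhds 0) := by
    have hr : Tendsto (fun t => max (lam - x t + y t) 0 + max (x t - lam) 0) atTop (nhds 0) := by
      simpa using hzlim.add hexlim
    refine tendsto_of_tendsto_of_tendsto_of_le_of_le' tendsto_const_nhds hr ?_ ?_
    · filter_upwards [eventually_ge_atTop 0] with t ht using hy0 t ht
    · exact Eventually.of_forall fun t => by
        linarith [le_max_left (x t - lam) 0, le_max_left (lam - x t + y t) 0]
  have hwz : ∀ t, 0 ≤ t → w t ≤ max (lam - x t + y t) 0 := fun t ht => by
    linarith [hdom t ht, hmin0 t ht]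
  have hd1lim : Tendsto d1 atTop (nhds 0) :=
    hd1d.tendsto_zero hd1c hd1 hnu (fun t ht => by linarith [hvw t ht, hwz t ht]) hzlim
  have hulim : Tendsto (fun t => 1 - x t - d0 t - d1 t) atTop (nhds 0) := by
    have hud : HasDrift (fun t => 1 + -x t + -d0 t + -d1 t) _ :=
      (((HasDrift.const 1).add hxd.neg).add hd0d.neg).add hd1d.neg
    have hueq : (fun t => 1 + -x t + -d0 t + -d1 t) = fun t => 1 - x t - d0 t - d1 t := by
      funext t
      ring
    rw [hueq] at hud
    refine hud.tendsto_zero (g := fun t => max (x t - lam) 0 + max (lam - x t + y t) 0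
      + nu * d1 t) (by fun_prop) hu0 hmu (fun t ht => ?_) ?_
    · linarith [hwz t ht, le_max_left (x t - lam) 0, hy0 t ht]
    · simpa using (hexlim.add hzlim).add (hd1lim.const_mul nu)
  refine ⟨hxlim, hylim, ?_, hd1lim⟩
  have h := ((tendsto_const_nhds (x := (1 : ℝ))).sub hxlim |>.sub hd1lim).sub hulim
  simp only [sub_zero] at h
  exact h.congr fun t => by ring

section Coefficients

variable {lam nu d0 d1 : ℝ} {q : ℕ → ℝ}

lemma fluidP0_nonneg (hlam : 0 < lam) (hnu : 0 < nu) (hd1 : 0 ≤ d1) (hq : q 2 ≤ q 1) :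
    0 ≤ fluidP0 lam nu q d0 d1 := by
  unfold fluidP0
  split_ifs
  · exact zero_le_one
  · refine le_min (mul_nonneg (inv_nonneg.2 hlam.le) ?_) zero_le_one
    have := mul_nonneg hd1 hnu.le
    linarith

lemma fluidP0_le_one : fluidP0 lam nu q d0 d1 ≤ 1 := by
  unfold fluidP0
  split_ifs
  exacts [le_rfl, min_le_right _ _]

lemma lam_mul_one_sub_fluidP0 (hlam : 0 < lam) (hu : ¬ 1 - q 1 - d0 - d1 > 0) :
    lam * (1 - fluidP0 lam nu q d0 d1) = max (lam - q 1 + q 2 - nu * d1) 0 := by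
  rw [fluidP0, if_neg hu, mul_sub, mul_min_of_nonneg _ _ hlam.le, ← mul_assoc,
    mul_inv_cancel₀ hlam.ne', one_mul, mul_one]
  rcases le_total (d1 * nu + q 1 - q 2) lam with h | h
  · rw [min_eq_left h, max_eq_left (by linarith)]
    ring
  · rw [min_eq_right h, max_eq_right (by linarith), sub_self]

lemma fluidP_mem_Icc (hlam : 0 < lam) (hnu : 0 < nu) (hd1 : 0 ≤ d1) (hq : q 2 ≤ q 1) {i : ℕ}
    (hi : 1 ≤ i → 0 ≤ q (i + 1) ∧ q (i + 1) ≤ q i ∧ q i ≤ q 1) :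
    fluidP lam nu q d0 d1 i ∈ Set.Icc (0 : ℝ) 1 := by
  have h0 := fluidP0_nonneg (d0 := d0) hlam hnu hd1 hq
  have h1 := fluidP0_le_one (lam := lam) (nu := nu) (q := q) (d0 := d0) (d1 := d1)
  cases i with
  | zero => exact ⟨h0, h1⟩
  | succ i =>
    obtain ⟨ha, hb, hc⟩ := hi (by lia)
    have hq1 : 0 ≤ q 1 := by linarith
    refine ⟨div_nonneg (mul_nonneg (by linarith) (by linarith)) hq1, div_le_one_of_le₀ ?_ hq1⟩
    nlinarith

lemma sum_fluidP_le_one {B : ℕ} (hq : 0 ≤ q (B + 1)) (hq1 : 0 ≤ q 1) :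
    ∑ i ∈ Finset.range (B + 1), fluidP lam nu q d0 d1 i ≤ 1 := by
  have hp := fluidP0_le_one (lam := lam) (nu := nu) (q := q) (d0 := d0) (d1 := d1)
  rw [Finset.sum_range_succ']
  simp only [fluidP]
  rw [← Finset.sum_div, ← Finset.mul_sum,
    Finset.sum_range_sub' (fun i => q (i + 1)) B, zero_add]
  have : (1 - fluidP0 lam nu q d0 d1) * (q 1 - q (B + 1)) / q 1
      ≤ 1 - fluidP0 lam nu q d0 d1 := by
    refine div_le_of_le_mul₀ hq1 (by linarith) ?_
    exact mul_le_mul_of_nonneg_left (by linarith) (by linarith)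
  linarith

lemma measurable_fluidP0 {q : ℕ → ℝ → ℝ} {d0 d1 : ℝ → ℝ} (hq : ∀ i, Continuous (q i))
    (h0 : Continuous d0) (h1 : Continuous d1) :
    Measurable fun s => fluidP0 lam nu (fun k => q k s) (d0 s) (d1 s) := by
  have hm := fun i => (hq i).measurable
  have hu : Measurable fun s => 1 - q 1 s - d0 s - d1 s :=
    (((continuous_const.sub (hq 1)).sub h0).sub h1).measurable
  unfold fluidP0
  refine Measurable.ite (measurableSet_lt measurable_const hu) measurable_const ?_
  exact ((((h1.measurable.mul_const nu).add (hm 1)).sub (hm 2)).const_mul _).min measurable_const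

lemma measurable_fluidP {q : ℕ → ℝ → ℝ} {d0 d1 : ℝ → ℝ} (hq : ∀ i, Continuous (q i))
    (h0 : Continuous d0) (h1 : Continuous d1) (i : ℕ) :
    Measurable fun s => fluidP lam nu (fun k => q k s) (d0 s) (d1 s) i := by
  have hp := measurable_fluidP0 (lam := lam) (nu := nu) hq h0 h1
  have hm := fun i => (hq i).measurable
  cases i with
  | zero => exact hp
  | succ i => exact ((hp.const_sub 1).mul ((hm (i + 1)).sub (hm (i + 2)))).div (hm 1)

end Coefficients

/-- Global stability of the fluid limit (Proposition 3.2): for any initial condition in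
`E`, the solution of the fluid-limit integral equations with constant arrival rate
`λ ∈ (0,1)` converges, as `t → ∞`, to the fixed point
`q₁* = λ`, `qᵢ* = 0` for `i = 2,…,B`, `δ₀* = 1 - λ`, `δ₁* = 0`. -/
theorem global_stability_fluid_limit (B : ℕ) (hB : 1 ≤ B) (lam mu nu : ℝ)
    (hlam0 : 0 < lam) (hlam1 : lam < 1) (hmu : 0 < mu) (hnu : 0 < nu)
    (q : ℕ → ℝ → ℝ) (d0 d1 : ℝ → ℝ)
    (hqcont : ∀ i, Continuous (q i)) (hd0cont : Continuous d0) (hd1cont : Continuous d1)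
    -- the trajectory stays in E for all t ≥ 0
    (hq01 : ∀ i t, 1 ≤ i → i ≤ B → 0 ≤ t → q i t ∈ Set.Icc (0:ℝ) 1)
    (hmono : ∀ i t, 1 ≤ i → i ≤ B → 0 ≤ t → q (i + 1) t ≤ q i t)
    (hqB : ∀ t, 0 ≤ t → q (B + 1) t = 0)
    (hd0mem : ∀ t, 0 ≤ t → d0 t ∈ Set.Icc (0:ℝ) 1)
    (hd1mem : ∀ t, 0 ≤ t → d1 t ∈ Set.Icc (0:ℝ) 1)
    (hEsum : ∀ t, 0 ≤ t → d0 t + d1 t + q 1 t ≤ 1)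
    -- the fluid-limit integral equations
    (hqeq : ∀ i t, 1 ≤ i → i ≤ B → 0 ≤ t →
      q i t = q i 0 +
        (∫ s in (0:ℝ)..t,
          lam * fluidP lam nu (fun k => q k s) (d0 s) (d1 s) (i - 1)) -
        ∫ s in (0:ℝ)..t, (q i s - q (i + 1) s))
    (hd0eq : ∀ t, 0 ≤ t →
      d0 t = d0 0 + mu * (∫ s in (0:ℝ)..t, (1 - q 1 s - d0 s - d1 s)) -
        ∫ s in (0:ℝ)..t,
          (if d0 s > 0 then
            lam * (1 - fluidP0 lam nu (fun k => q k s) (d0 s) (d1 s)) else 0))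
    (hd1eq : ∀ t, 0 ≤ t →
      d1 t = d1 0 +
        (∫ s in (0:ℝ)..t,
          (if d0 s > 0 then
            lam * (1 - fluidP0 lam nu (fun k => q k s) (d0 s) (d1 s)) else 0)) -
        nu * ∫ s in (0:ℝ)..t, d1 s) :
    Tendsto (q 1) atTop (nhds lam) ∧
    (∀ i, 2 ≤ i → i ≤ B → Tendsto (q i) atTop (nhds 0)) ∧
    Tendsto d0 atTop (nhds (1 - lam)) ∧
    Tendsto d1 atTop (nhds 0) := by
  have hqle : ∀ t, 0 ≤ t → ∀ i, 1 ≤ i → i ≤ B + 1 → q i t ≤ q 1 t := fun t ht i hi => by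
    induction i, hi using Nat.le_induction with
    | base => exact fun _ => le_rfl
    | succ i hi ih => exact fun hiB => (hmono i t hi (by lia) ht).trans (ih (by lia))
  have hqnn : ∀ t, 0 ≤ t → ∀ i, 1 ≤ i → i ≤ B + 1 → 0 ≤ q i t := fun t ht i hi hiB => by
    rcases Nat.lt_or_ge B i with h | h
    · rw [show i = B + 1 by lia, hqB t ht]
    · exact (hq01 i t hi h ht).1
  have hq21 : ∀ t, 0 ≤ t → q 2 t ≤ q 1 t := fun t ht => hmono 1 t le_rfl hB ht
  have hPm : ∀ t, 0 ≤ t → ∀ i, i < B →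
      fluidP lam nu (fun k => q k t) (d0 t) (d1 t) i ∈ Set.Icc (0 : ℝ) 1 := fun t ht i hi =>
    fluidP_mem_Icc (q := fun k => q k t) hlam0 hnu (hd1mem t ht).1 (hq21 t ht) fun h1 =>
      ⟨hqnn t ht (i + 1) (by lia) (by lia), hmono i t h1 hi.le ht, hqle t ht i h1 (by lia)⟩
  have hPi : ∀ i, i < B → ∀ a b, 0 ≤ a → 0 ≤ b → IntervalIntegrable
      (fun s => lam * fluidP lam nu (fun k => q k s) (d0 s) (d1 s) i)
      MeasureTheory.volume a b := fun i hi a b ha hb =>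
    (intervalIntegrable_of_abs_le (measurable_fluidP hqcont hd0cont hd1cont i) (C := 1)
      (fun s hs => abs_le.2 ⟨by linarith [(hPm s hs i hi).1], (hPm s hs i hi).2⟩)
      ha hb).const_mul lam
  have hqd : ∀ i, 1 ≤ i → i ≤ B → HasDrift (q i) fun s =>
      lam * fluidP lam nu (fun k => q k s) (d0 s) (d1 s) (i - 1) - (q i s - q (i + 1) s) :=
    fun i hi hiB => by
    have hc : Continuous fun s => q i s - q (i + 1) s := (hqcont i).sub (hqcont (i + 1))
    have hP := hPi (i - 1) (by lia)
    refine HasDrift.of_eq_add_integral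
      (fun a b ha hb => (hP a b ha hb).sub (hc.intervalIntegrable a b)) fun t ht => ?_
    rw [intervalIntegral.integral_sub (hP 0 t le_rfl ht) (hc.intervalIntegrable 0 t),
      hqeq i t hi hiB ht]
    ring
  have hP0 := fun t (ht : 0 ≤ t) =>
    fluidP0_nonneg (q := fun k => q k t) (d0 := d0 t) hlam0 hnu (hd1mem t ht).1 (hq21 t ht)
  have hP1 := fun t => fluidP0_le_one (lam := lam) (nu := nu) (q := fun k => q k t)
    (d0 := d0 t) (d1 := d1 t)
  have hw0 : ∀ t, 0 ≤ t →
      0 ≤ lam * (1 - fluidP0 lam nu (fun k => q k t) (d0 t) (d1 t)) := fun t _ =>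
    mul_nonneg hlam0.le (by linarith [hP1 t])
  have hwle : ∀ t, 0 ≤ t →
      lam * (1 - fluidP0 lam nu (fun k => q k t) (d0 t) (d1 t)) ≤ lam := fun t ht => by
    nlinarith [hP0 t ht]
  have hvi : ∀ a b, 0 ≤ a → 0 ≤ b → IntervalIntegrable (fun s => if d0 s > 0 then
      lam * (1 - fluidP0 lam nu (fun k => q k s) (d0 s) (d1 s)) else 0)
      MeasureTheory.volume a b := fun a b ha hb => by
    refine intervalIntegrable_of_abs_le (C := lam) (Measurable.ite
      (measurableSet_lt measurable_const hd0cont.measurable)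
      (((measurable_fluidP0 hqcont hd0cont hd1cont).const_sub 1).const_mul lam)
      measurable_const) (fun s hs => ?_) ha hb
    have h0 := hw0 s hs
    have h1 := hwle s hs
    split_ifs
    · exact abs_le.2 ⟨by linarith, h1⟩
    · simpa using hlam0.le
  have hd0d : HasDrift d0 fun s => mu * (1 - q 1 s - d0 s - d1 s) -
      if d0 s > 0 then lam * (1 - fluidP0 lam nu (fun k => q k s) (d0 s) (d1 s)) else 0 := by
    have hq1c := hqcont 1
    have hc : Continuous fun s => mu * (1 - q 1 s - d0 s - d1 s) := by fun_prop
    refine HasDrift.of_eq_add_integral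
      (fun a b ha hb => (hc.intervalIntegrable a b).sub (hvi a b ha hb)) fun t ht => ?_
    rw [intervalIntegral.integral_sub (hc.intervalIntegrable 0 t) (hvi 0 t le_rfl ht),
      intervalIntegral.integral_const_mul]
    linarith [hd0eq t ht]
  have hd1d : HasDrift d1 fun s =>
      (if d0 s > 0 then lam * (1 - fluidP0 lam nu (fun k => q k s) (d0 s) (d1 s)) else 0) -
        nu * d1 s := by
    have hc : Continuous fun s => nu * d1 s := by fun_prop
    refine HasDrift.of_eq_add_integral
      (fun a b ha hb => (hvi a b ha hb).sub (hc.intervalIntegrable a b)) fun t ht => ?_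
    rw [intervalIntegral.integral_sub (hvi 0 t le_rfl ht) (hc.intervalIntegrable 0 t),
      intervalIntegral.integral_const_mul]
    linarith [hd1eq t ht]
  have hxd : HasDrift (q 1) fun t => lam - q 1 t + q 2 t -
      lam * (1 - fluidP0 lam nu (fun k => q k t) (d0 t) (d1 t)) := by
    convert hqd 1 le_rfl hB using 2 with t
    simp only [Nat.sub_self, fluidP]
    ring
  have hyl : LipschitzIci (q 2) := by
    rcases hB.eq_or_lt with h | h
    · subst h
      exact ⟨0, fun s t hs hst => by simp [hqB s hs, hqB t (hs.trans hst)]⟩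
    · refine (hqd 2 (by lia) h).lipschitzIci (C := 1) fun t ht => ?_
      have h1 := hPm t ht (2 - 1) (by lia)
      have h2 := mul_nonneg hlam0.le h1.1
      have h3 := mul_le_mul_of_nonneg_left h1.2 hlam0.le
      have h4 := hmono 2 t (by lia) h ht
      have h5 := (hq01 2 t (by lia) h ht).2
      have h6 := hqnn t ht 3 (by lia) (by lia)
      exact abs_le.2 ⟨by linarith, by linarith⟩
  have hwpos : ∀ t, 0 ≤ t → 0 < 1 - q 1 t - d0 t - d1 t →
      lam * (1 - fluidP0 lam nu (fun k => q k t) (d0 t) (d1 t)) = 0 := fun t _ hu => by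
    rw [fluidP0, if_pos hu, sub_self, mul_zero]
  have hwzero : ∀ t, 0 ≤ t → 1 - q 1 t - d0 t - d1 t = 0 →
      lam * (1 - fluidP0 lam nu (fun k => q k t) (d0 t) (d1 t)) =
        max (lam - q 1 t + q 2 t - nu * d1 t) 0 := fun t _ hu =>
    lam_mul_one_sub_fluidP0 (q := fun k => q k t) hlam0 hu.le.not_gt
  have hxge : ∀ T t, 0 ≤ T → T ≤ t → lam ≤ q 1 T → lam ≤ q 1 t := fun T t hT hTt hxT => by
    have := le_of_nonincreasing_above (f := fun t => -q 1 t) (hqcont 1).neg hTt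
      (neg_le_neg hxT) fun s t hs hst hr => by
        have := hxd.neg.sub_le (m := 0) (hT.trans hs) hst fun r hrm => by
          have hr0 := hT.trans (hs.trans hrm.1)
          have h1 : q 1 r ≤ lam := neg_le_neg_iff.1 (hr r hrm)
          have h2 := hqnn r hr0 2 (by lia) (by lia)
          have h3 := mul_nonneg hnu.le (hd1mem r hr0).1
          rcases (show 0 ≤ 1 - q 1 r - d0 r - d1 r by linarith [hEsum r hr0]).eq_or_lt with h | h
          · rw [hwzero r hr0 h.symm]
            rcases max_cases (lam - q 1 r + q 2 r - nu * d1 r) 0 with h | h <;> linarith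
          · rw [hwpos r hr0 h]
            linarith
        linarith
    exact neg_le_neg_iff.1 this
  have hexc : Continuous fun t => max (q 1 t - lam) 0 := by
    have hq1c := hqcont 1
    fun_prop
  obtain ⟨C, hC⟩ : ∃ C, ∀ t, 0 ≤ t → ∫ r in (0 : ℝ)..t, max (q 1 r - lam) 0 ≤ C := by
    by_cases hT : ∃ T, 0 ≤ T ∧ lam ≤ q 1 T
    · obtain ⟨T, hT0, hT⟩ := hT
      have hS := HasDrift.sum (Finset.range B) (F := fun i => q (i + 1))
        fun i hi => hqd (i + 1) (by lia) (Finset.mem_range.1 hi)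
      have hSle : ∀ s t, T ≤ s → s ≤ t → ∫ r in s..t, max (q 1 r - lam) 0 ≤
          (∑ i ∈ Finset.range B, q (i + 1) s) - ∑ i ∈ Finset.range B, q (i + 1) t :=
        fun s t hs hst => by
        have hneg := (hexc.intervalIntegrable s t (μ := MeasureTheory.volume)).neg
        have h := hS.sub_le_integral (hT0.trans hs) hst hneg fun r hr => by
          have hr0 := hT0.trans (hs.trans hr.1)
          have h1 := hxge T r hT0 (hs.trans hr.1) hT
          obtain ⟨b, rfl⟩ : ∃ b, B = b + 1 := ⟨B - 1, by lia⟩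
          have h2 := sum_fluidP_le_one (lam := lam) (nu := nu) (q := fun k => q k r)
            (d0 := d0 r) (d1 := d1 r) (B := b) (hqnn r hr0 (b + 1) (by lia) (by lia))
            (hqnn r hr0 1 le_rfl (by lia))
          have h3 := mul_le_mul_of_nonneg_left h2 hlam0.le
          simp only [Nat.add_sub_cancel, Pi.neg_apply]
          rw [Finset.sum_sub_distrib, ← Finset.mul_sum,
            Finset.sum_range_sub' (fun i => q (i + 1) r) (b + 1), hqB r hr0,
            max_eq_left (by linarith)]
          simp only [zero_add]
          linarith
        simp only [Pi.neg_apply] at h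
        rw [intervalIntegral.integral_neg] at h
        linarith
      refine ⟨(∫ r in (0 : ℝ)..T, max (q 1 r - lam) 0) +
        ∑ i ∈ Finset.range B, q (i + 1) T, fun t ht => ?_⟩
      have hsplit := intervalIntegral.integral_add_adjacent_intervals
        (hexc.intervalIntegrable 0 T (μ := MeasureTheory.volume)) (hexc.intervalIntegrable T t)
      have hSnn : ∀ t, 0 ≤ t → 0 ≤ ∑ i ∈ Finset.range B, q (i + 1) t := fun t ht =>
        Finset.sum_nonneg fun i hi =>
          hqnn t ht (i + 1) (by lia) (by have := Finset.mem_range.1 hi; lia)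
      rcases le_total T t with h | h
      · linarith [hSle T t le_rfl h, hSnn t ht]
      · have h1 : 0 ≤ ∫ r in t..T, max (q 1 r - lam) 0 :=
          intervalIntegral.integral_nonneg h fun r _ => le_max_right _ _
        rw [intervalIntegral.integral_symm] at h1
        linarith [hSnn T hT0]
    · push Not at hT
      refine ⟨0, fun t ht => ?_⟩
      rw [intervalIntegral.integral_congr (g := fun _ => (0 : ℝ)) fun r hr => by
        rw [Set.uIcc_of_le ht] at hr
        exact max_eq_right (by linarith [hT r hr.1])]
      simp
  obtain ⟨hx, hy, h0, h1⟩ := fluid_tendsto_of_integral_excess_le hlam0 hlam1 hmu hnu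
    (hqcont 1) (hqcont 2) hd0cont hd1cont (fun t ht => hqnn t ht 1 le_rfl (by lia))
    (fun t ht => hqnn t ht 2 (by lia) (by lia)) hq21 (fun t ht => (hd0mem t ht).1)
    (fun t ht => (hd1mem t ht).1) hEsum hwpos hwzero hwle hxd hyl hd0d hd1d hC
  refine ⟨hx, fun i hi => ?_, h0, h1⟩
  induction i, hi using Nat.le_induction with
  | base => exact fun _ => hy
  | succ i hi ih =>
    intro hiB
    refine tendsto_of_tendsto_of_tendsto_of_le_of_le' tendsto_const_nhds (ih (by lia)) ?_ ?_
    · filter_upwards [eventually_ge_atTop 0] with t ht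
      exact hqnn t ht (i + 1) (by lia) (by lia)
    · filter_upwards [eventually_ge_atTop 0] with t ht
      exact hmono i t (by lia) (by lia) ht
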